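/- arXiv:hep-th/0508155 — 7 statements merged into one kernel-verified Lean document; each statement's English description precedes it below -/
import Mathlib

section
/- Let (A,R) be a Rota–Baxter algebra of weight one with A commutative, n ≥ 1, and let a ∈ M_n(A) be strictly upper triangular. Then the equation b = 1 − 𝓡(b·a) has a unique solution b ∈ M_n(A), where 𝓡 applies R entrywise and 1 is the identity matrix; moreover this solution b is unipotent upper triangular, i.e. b − 1 is strictly upper triangular. -/
namespace Matrix

variable {A : Type*} [CommRing A] {n : ℕ}

/-- If `a` is strictly upper triangular, then the first `k` columns of the `k`-th iterate of
`b ↦ 1 - 𝓡(b·a)` do not depend on the starting matrix. -/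
theorem iterate_one_sub_map_mul_apply_eq (R : A → A) {a : Matrix (Fin n) (Fin n) A}
    (ha : ∀ i j : Fin n, j ≤ i → a i j = 0) (x y : Matrix (Fin n) (Fin n) A) (k : ℕ)
    (i j : Fin n) (hj : (j : ℕ) < k) :
    (fun b : Matrix (Fin n) (Fin n) A => 1 - (b * a).map R)^[k] x i j =
      (fun b : Matrix (Fin n) (Fin n) A => 1 - (b * a).map R)^[k] y i j := by
  induction k generalizing i j with
  | zero => omega
  | succ k ih =>
    simp only [Function.iterate_succ_apply', sub_apply, map_apply, mul_apply]
    congr 2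
    refine Finset.sum_congr rfl fun m _ => ?_
    rcases le_or_gt j m with hm | hm
    · rw [ha m j hm, mul_zero, mul_zero]
    · rw [ih i m (by have := Fin.lt_def.mp hm; omega)]

theorem existsUnique_eq_one_sub_map_mul (R : A → A) {a : Matrix (Fin n) (Fin n) A}
    (ha : ∀ i j : Fin n, j ≤ i → a i j = 0) :
    ∃! b : Matrix (Fin n) (Fin n) A, b = 1 - (b * a).map R := by
  set F := fun b : Matrix (Fin n) (Fin n) A => 1 - (b * a).map R with hF
  have hconst : ∀ x y, F^[n] x = F^[n] y := fun x y => by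
    ext i j
    exact iterate_one_sub_map_mul_apply_eq R ha x y n i j j.isLt
  refine ⟨F^[n] 0, ?_, fun b hb => ?_⟩
  · change F^[n] 0 = F (F^[n] 0)
    rw [← Function.iterate_succ_apply' F, Function.iterate_succ_apply]
    exact hconst _ _
  · rw [← hconst b 0]
    exact (Function.iterate_fixed (f := F) hb.symm n).symm

theorem sub_one_apply_eq_zero_of_eq_one_sub_map_mul {R : A → A} (hR : R 0 = 0)
    {a b : Matrix (Fin n) (Fin n) A} (ha : ∀ i j : Fin n, j ≤ i → a i j = 0)
    (hb : b = 1 - (b * a).map R) (i j : Fin n) (hij : j ≤ i) : (b - 1) i j = 0 := by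
  induction j using WellFoundedLT.induction with
  | ind j ih =>
    have hsum : (b * a) i j = 0 := by
      rw [mul_apply]
      refine Finset.sum_eq_zero fun m _ => ?_
      rcases le_or_gt j m with hm | hm
      · rw [ha m j hm, mul_zero]
      · have hmi : m < i := hm.trans_le hij
        have h := ih m hm hmi.le
        rw [sub_apply, one_apply_ne hmi.ne', sub_zero] at h
        rw [h, zero_mul]
    rw [hb, sub_sub_cancel_left, neg_apply, map_apply, hsum, hR, neg_zero]

end Matrix


/-- Let `(A,R)` be a commutative Rota–Baxter algebra of weight one,
`n ≥ 1`, and `a ∈ M_n(A)` strictly upper triangular. Then the equation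
`b = 1 − 𝓡(b·a)` (with `𝓡` the entrywise extension of `R`) has a unique solution
in `M_n(A)`, and any solution is unipotent upper triangular. -/
theorem matrix_counterterm_eq_unique_sol {K A : Type*} [Field K] [CharZero K] [CommRing A]
    [Algebra K A] (R : A →ₗ[K] A)
    (hR : ∀ x y : A, R x * R y + R (x * y) = R (R x * y + x * R y))
    (n : ℕ) (hn : 1 ≤ n)
    (a : Matrix (Fin n) (Fin n) A)
    (ha : ∀ i j : Fin n, j ≤ i → a i j = 0) :
    (∃! b : Matrix (Fin n) (Fin n) A, b = 1 - (b * a).map ⇑R) ∧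
    (∀ b : Matrix (Fin n) (Fin n) A, b = 1 - (b * a).map ⇑R →
      ∀ i j : Fin n, j ≤ i → (b - 1) i j = 0) := by
  exact ⟨Matrix.existsUnique_eq_one_sub_map_mul R ha, fun _ hb =>
    Matrix.sub_one_apply_eq_zero_of_eq_one_sub_map_mul (map_zero R) ha hb⟩
end

section
/- (Atkinson's factorization for triangular matrices.) Let (A,R) be a Rota–Baxter algebra of weight one with A commutative, R̃ := id_A − R, n ≥ 1, and let a ∈ M_n(A) be strictly upper triangular. Let b ∈ M_n(A) be the unique solution of b = 1 − 𝓡(b·a) and b' ∈ M_n(A) the unique solution of b' = 1 − 𝓡̃(a·b'). Then b·(1 + a)·b' = 1, i.e. 1 + a = b^{-1}·b'^{-1}. -/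
/-- Applying a Rota–Baxter operator of weight one entrywise gives a Rota–Baxter operator on
square matrices. -/
theorem Matrix.map_rotaBaxter {ι A : Type*} [Fintype ι] [Ring A] (R : A →+ A)
    (hR : ∀ x y : A, R x * R y + R (x * y) = R (R x * y + x * R y)) (X Y : Matrix ι ι A) :
    R.mapMatrix X * R.mapMatrix Y + R.mapMatrix (X * Y) =
      R.mapMatrix (R.mapMatrix X * Y + X * R.mapMatrix Y) := by
  ext i j
  simp only [Matrix.add_apply, Matrix.mul_apply, AddMonoidHom.mapMatrix_apply, Matrix.map_apply,
    map_sum, ← Finset.sum_add_distrib, hR]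

/-- **Atkinson's factorization** in a ring with a Rota–Baxter operator of weight one. -/
theorem atkinson_factorization {B : Type*} [Ring B] (P : B →+ B)
    (hP : ∀ x y : B, P x * P y + P (x * y) = P (P x * y + x * P y)) {a b b' : B}
    (hb : b = 1 - P (b * a)) (hb' : b' = 1 - (a * b' - P (a * b'))) :
    b * (1 + a) * b' = 1 := by
  have hu : P (b * a) = 1 - b := by rw [eq_sub_iff_add_eq, add_comm, ← eq_sub_iff_add_eq, ← hb]
  have hv : P (a * b') = b' - 1 + a * b' := by
    nth_rewrite 2 [hb']
    abel
  have key := hP (b * a) (a * b')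
  have hsum : P (b * a) * (a * b') + b * a * P (a * b') =
      a * b' - b * a + b * a * (a * b') := by
    rw [hu, hv]; noncomm_ring
  rw [hsum, map_add, map_sub, add_left_inj, hu, hv] at key
  have hzero : b * (1 + a) * b' - 1 = -((1 - b) * (b' - 1 + a * b') -
      (b' - 1 + a * b' - (1 - b))) := by noncomm_ring
  rw [← sub_eq_zero, hzero, key, sub_self, neg_zero]

/-- **Atkinson's factorization for triangular matrices.**
Let `(A,R)` be a commutative Rota–Baxter algebra of weight one, `R̃ := id − R`,
`n ≥ 1`, `a ∈ M_n(A)` strictly upper triangular. If `b` solves `b = 1 − 𝓡(b·a)`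
and `b'` solves `b' = 1 − 𝓡̃(a·b')`, then `b·(1 + a)·b' = 1`. -/
theorem matrix_atkinson_factorization {K A : Type*} [Field K] [CharZero K] [CommRing A]
    [Algebra K A] (R : A →ₗ[K] A)
    (hR : ∀ x y : A, R x * R y + R (x * y) = R (R x * y + x * R y))
    (n : ℕ) (hn : 1 ≤ n)
    (a : Matrix (Fin n) (Fin n) A)
    (ha : ∀ i j : Fin n, j ≤ i → a i j = 0)
    (b b' : Matrix (Fin n) (Fin n) A)
    (hb : b = 1 - (b * a).map ⇑R)
    (hb' : b' = 1 - (a * b').map (fun x => x - R x)) :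
    b * (1 + a) * b' = 1 := by
  refine atkinson_factorization R.toAddMonoidHom.mapMatrix
    (Matrix.map_rotaBaxter R.toAddMonoidHom hR) hb (hb'.trans ?_)
  ext i j
  simp
end

section
/- Let (A,R) be a Rota–Baxter algebra of weight one with A commutative, R̃ := id_A − R, n ≥ 1, and let a ∈ M_n(A) be strictly upper triangular. Let b̄ ∈ M_n(A) be the unique solution of b̄ = 1 − 𝓡(a·b̄) and b̄' ∈ M_n(A) the unique solution of b̄' = 1 − 𝓡̃(b̄'·a) (both such solutions exist, are unique, and are unipotent upper triangular). Then b̄'·(1 + a)·b̄ = 1, i.e. 1 + a = b̄'^{-1}·b̄^{-1}. -/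
/-- An equation `b = c - S (a * b)` with `a` strictly upper triangular and `S` acting entrywise
has a unique solution, obtained by recursion on the rows from the bottom up. -/
theorem existsUnique_eq_sub_map_mul {ι A : Type*} [Fintype ι] [LinearOrder ι] [Ring A]
    (S : A → A) (a c : Matrix ι ι A) (ha : ∀ i j : ι, j ≤ i → a i j = 0) :
    ∃! b : Matrix ι ι A, b = c - (a * b).map S := by
  have wf : WellFounded (fun x y : ι => y < x) := wellFounded_gt
  let F : ∀ i : ι, (∀ k : ι, i < k → ι → A) → ι → A := fun i rec j =>
    c i j - S (∑ k, if h : i < k then a i k * rec k h j else 0)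
  refine ⟨Matrix.of (wf.fix F), ?_, fun b hb => ?_⟩
  · ext i j
    rw [Matrix.of_apply, wf.fix_eq, Matrix.sub_apply, Matrix.map_apply, Matrix.mul_apply]
    dsimp only [F]
    congr 2
    refine Finset.sum_congr rfl fun k _ => ?_
    split_ifs with h
    · rw [Matrix.of_apply]
    · rw [ha i k (not_lt.mp h), zero_mul]
  · refine Matrix.ext fun i j => ?_
    rw [Matrix.of_apply]
    induction i using wf.induction with
    | _ i ih =>
      rw [wf.fix_eq, hb, Matrix.sub_apply, Matrix.map_apply, Matrix.mul_apply]
      dsimp only [F]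
      congr 2
      refine Finset.sum_congr rfl fun k _ => ?_
      split_ifs with h
      · rw [ih k h]
      · rw [ha i k (not_lt.mp h), zero_mul]

/-- If `a` is strictly upper triangular and `c` is upper triangular, then solutions of
`b = c - S (a * b)` agree with `c` on and below the diagonal. -/
theorem sub_apply_eq_zero_of_eq_sub_map_mul {ι A : Type*} [Fintype ι] [LinearOrder ι]
    [Ring A] (S : A → A) (hS : S 0 = 0) (a b c : Matrix ι ι A)
    (ha : ∀ i j : ι, j ≤ i → a i j = 0) (hc : ∀ i j : ι, j < i → c i j = 0)
    (hb : b = c - (a * b).map S) (i j : ι) (hij : j ≤ i) : (b - c) i j = 0 := by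
  have wf : WellFounded (fun x y : ι => y < x) := wellFounded_gt
  induction i using wf.induction with
  | _ i ih =>
    have hsum : (a * b) i j = 0 := by
      rw [Matrix.mul_apply]
      refine Finset.sum_eq_zero fun k _ => ?_
      rcases lt_or_ge i k with h | h
      · have hk := ih k h (hij.trans h.le)
        rw [Matrix.sub_apply, hc k j (hij.trans_lt h), sub_zero] at hk
        rw [hk, mul_zero]
      · rw [ha i k h, zero_mul]
    have hij' := congrFun (congrFun hb i) j
    rw [Matrix.sub_apply, Matrix.map_apply, hsum, hS, sub_zero] at hij'
    rw [Matrix.sub_apply, hij', sub_self]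

/-- Transposition turns `b = 1 - S (b * a)` into `bᵀ = 1 - S (aᵀ * bᵀ)`. -/
theorem transpose_eq_one_sub_map_mul_iff {ι A : Type*} [Fintype ι] [DecidableEq ι] [CommRing A]
    (S : A → A) (a b : Matrix ι ι A) :
    b.transpose = 1 - (a.transpose * b.transpose).map S ↔ b = 1 - (b * a).map S := by
  rw [← Matrix.transpose_mul, Matrix.transpose_map, ← Matrix.transpose_inj (A := b),
    Matrix.transpose_sub, Matrix.transpose_one]

/-- The Rota–Baxter relation, in mixed form `R̃(y)R(x) = R(R̃(y)x) + R̃(yR(x))`, for matrices. -/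
theorem map_sub_mul_map_of_rotaBaxter {ι A : Type*} [Fintype ι] [Ring A] (R : A →+ A)
    (hR : ∀ x y : A, R x * R y + R (x * y) = R (R x * y + x * R y)) (x y : Matrix ι ι A) :
    (y.map fun t => t - R t) * x.map R =
      ((y.map fun t => t - R t) * x).map R + (y * x.map R).map fun t => t - R t := by
  ext i j
  simp only [Matrix.add_apply, Matrix.map_apply, Matrix.mul_apply, map_sum,
    ← Finset.sum_sub_distrib, ← Finset.sum_add_distrib]
  refine Finset.sum_congr rfl fun k _ => ?_
  have h := hR (y i k) (x k j)
  rw [map_add] at h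
  rw [sub_mul, sub_mul, map_sub, eq_sub_of_add_eq h]
  abel

/-- Solutions of the two Atkinson equations factorize `1 + a`. -/
theorem mul_one_add_mul_eq_one_of_rotaBaxter {ι A : Type*} [Fintype ι] [DecidableEq ι] [Ring A]
    (R : A →+ A) (hR : ∀ x y : A, R x * R y + R (x * y) = R (R x * y + x * R y))
    (a b b' : Matrix ι ι A) (hb : b = 1 - (a * b).map R)
    (hb' : b' = 1 - (b' * a).map fun t => t - R t) : b' * (1 + a) * b = 1 := by
  have key := map_sub_mul_map_of_rotaBaxter R hR (a * b) (b' * a)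
  have hx : (a * b).map R = 1 - b := by rw [eq_sub_iff_add_eq, ← eq_sub_iff_add_eq', ← hb]
  have hy : ((b' * a).map fun t => t - R t) = 1 - b' := by
    rw [eq_sub_iff_add_eq, ← eq_sub_iff_add_eq', ← hb']
  have hl : (1 - b') * (a * b) = a * b - b' * a * b := by noncomm_ring
  have hr : b' * a * (1 - b) = b' * a - b' * a * b := by noncomm_ring
  have hR_sub : (a * b - b' * a * b).map R = (1 - b) - (b' * a * b).map R := by
    rw [← hx]
    ext i j
    simp
  have hR'_sub : ((b' * a - b' * a * b).map fun t => t - R t) =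
      (1 - b') - (b' * a * b - (b' * a * b).map R) := by
    rw [← hy]
    ext i j
    simp only [Matrix.sub_apply, Matrix.map_apply, map_sub]
    abel
  rw [hx, hy, hl, hr, hR_sub, hR'_sub] at key
  have hsum : b' * (1 + a) * b = (1 - b') * (1 - b) - (1 - b) - (1 - b') + b' * a * b + 1 := by
    noncomm_ring
  rw [hsum, key]
  abel


/-- Let `(A,R)` be a commutative Rota–Baxter algebra of weight one,
`R̃ := id − R`, `n ≥ 1`, `a ∈ M_n(A)` strictly upper triangular. The equations
`b̄ = 1 − 𝓡(a·b̄)` and `b̄' = 1 − 𝓡̃(b̄'·a)` have unique solutions, these solutions are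
unipotent upper triangular, and they satisfy `b̄'·(1 + a)·b̄ = 1`. -/
theorem matrix_atkinson_factorization_variant {K A : Type*} [Field K] [CharZero K]
    [CommRing A] [Algebra K A] (R : A →ₗ[K] A)
    (hR : ∀ x y : A, R x * R y + R (x * y) = R (R x * y + x * R y))
    (n : ℕ) (hn : 1 ≤ n)
    (a : Matrix (Fin n) (Fin n) A)
    (ha : ∀ i j : Fin n, j ≤ i → a i j = 0) :
    (∃! b : Matrix (Fin n) (Fin n) A, b = 1 - (a * b).map ⇑R) ∧
    (∃! b' : Matrix (Fin n) (Fin n) A, b' = 1 - (b' * a).map (fun x => x - R x)) ∧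
    (∀ b : Matrix (Fin n) (Fin n) A, b = 1 - (a * b).map ⇑R →
      ∀ i j : Fin n, j ≤ i → (b - 1) i j = 0) ∧
    (∀ b' : Matrix (Fin n) (Fin n) A, b' = 1 - (b' * a).map (fun x => x - R x) →
      ∀ i j : Fin n, j ≤ i → (b' - 1) i j = 0) ∧
    (∀ b b' : Matrix (Fin n) (Fin n) A,
      b = 1 - (a * b).map ⇑R →
      b' = 1 - (b' * a).map (fun x => x - R x) →
      b' * (1 + a) * b = 1) := by
  have hRt : (fun x => x - R x) 0 = 0 := by simp
  have hat : ∀ i j : (Fin n)ᵒᵈ, j ≤ i →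
      (a.transpose : Matrix (Fin n)ᵒᵈ (Fin n)ᵒᵈ A) i j = 0 := fun i j h => ha j i h
  refine ⟨existsUnique_eq_sub_map_mul R a 1 ha, ?_,
    fun b hb => sub_apply_eq_zero_of_eq_sub_map_mul R (map_zero R) a b 1 ha
      (fun i j h => Matrix.one_apply_ne h.ne') hb,
    fun b' hb' i j hij => ?_,
    fun b b' => mul_one_add_mul_eq_one_of_rotaBaxter R.toAddMonoidHom hR a b b'⟩
  · obtain ⟨c, hc, huniq⟩ := existsUnique_eq_sub_map_mul (ι := (Fin n)ᵒᵈ)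
      (fun x => x - R x) a.transpose (1 : Matrix (Fin n) (Fin n) A) hat
    exact ⟨c.transpose, (transpose_eq_one_sub_map_mul_iff _ a _).mp hc, fun d hd =>
      congrArg Matrix.transpose
        (huniq d.transpose ((transpose_eq_one_sub_map_mul_iff _ a d).mpr hd))⟩
  · have h := sub_apply_eq_zero_of_eq_sub_map_mul (ι := (Fin n)ᵒᵈ) (fun x => x - R x) hRt
      a.transpose b'.transpose (1 : Matrix (Fin n) (Fin n) A) hat
      (fun i j h => Matrix.one_apply_ne (n := Fin n) (ne_of_lt h))
      ((transpose_eq_one_sub_map_mul_iff _ a b').mpr hb') j i hij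
    rw [← Matrix.transpose_apply (b' - 1), Matrix.transpose_sub, Matrix.transpose_one]
    exact h
end

section
/- Let (A,R) be a Rota–Baxter algebra of weight one with A commutative and with R idempotent (R∘R = R); set R̃ := id_A − R. Let n ≥ 1 and let a ∈ M_n(A) be strictly upper triangular. Suppose 1 + a = (1 + 𝓡(u))^{-1}·(1 + 𝓡̃(v)) = (1 + 𝓡(u'))^{-1}·(1 + 𝓡̃(v')) where u, v, u', v' ∈ M_n(A) are strictly upper triangular. Then 𝓡(u) = 𝓡(u') and 𝓡̃(v) = 𝓡̃(v'); i.e. the decomposition of 1 + a into a product of an element of 1 + 𝓡(strictly upper triangular matrices) and an element of 1 + 𝓡̃(strictly upper triangular matrices) is unique. -/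
/-- If `m + m * w = d` with `w` strictly upper triangular and the entries of `d` and `w` lie in a
non-unital subring, then so do the entries of `m`. -/
theorem Matrix.mem_of_add_mul_strictUpper_eq {A ι : Type*} [CommRing A] [Fintype ι]
    [LinearOrder ι] (S : NonUnitalSubring A) {m w d : Matrix ι ι A}
    (hw : ∀ i j, j ≤ i → w i j = 0) (hwS : ∀ i j, w i j ∈ S) (hdS : ∀ i j, d i j ∈ S)
    (h : m + m * w = d) (i j : ι) : m i j ∈ S := by
  induction j using WellFoundedLT.induction with
  | ind j ih =>
    have hij : m i j = d i j - ∑ k, m i k * w k j := by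
      rw [← h, Matrix.add_apply, Matrix.mul_apply, add_sub_cancel_right]
    rw [hij]
    refine sub_mem (hdS i j) (sum_mem fun k _ => ?_)
    rcases lt_or_ge k j with hk | hk
    · exact mul_mem (ih k hk) (hwS k j)
    · rw [hw k j hk, mul_zero]
      exact zero_mem S

theorem Matrix.det_one_add_of_strictUpper {A ι : Type*} [CommRing A] [Fintype ι]
    [LinearOrder ι] {w : Matrix ι ι A} (hw : ∀ i j, j ≤ i → w i j = 0) :
    (1 + w).det = 1 := by
  rw [Matrix.det_of_isUpperTriangular]
  · exact Finset.prod_eq_one fun i _ => by simp [hw i i le_rfl]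
  · intro i j hij
    have hji : j < i := hij
    simp [hw i j hji.le, Matrix.one_apply_ne hji.ne']

/-- The fixed points of a Rota–Baxter operator of weight one, as a non-unital subring. -/
def rotaBaxterFixed {A : Type*} [CommRing A] (R : A →+ A)
    (hR : ∀ x y : A, R x * R y + R (x * y) = R (R x * y + x * R y)) :
    NonUnitalSubring A where
  carrier := {x | R x = x}
  add_mem' {x y} hx hy := by
    simp only [Set.mem_ofPred_eq] at *
    rw [map_add, hx, hy]
  zero_mem' := map_zero R
  neg_mem' {x} hx := by
    simp only [Set.mem_ofPred_eq] at *
    rw [map_neg, hx]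
  mul_mem' {x y} hx hy := by
    simp only [Set.mem_ofPred_eq] at *
    have h := hR x y
    rw [hx, hy, map_add] at h
    exact (add_right_cancel h).symm

/-- The kernel of a Rota–Baxter operator of weight one, as a non-unital subring. -/
def rotaBaxterKer {A : Type*} [CommRing A] (R : A →+ A)
    (hR : ∀ x y : A, R x * R y + R (x * y) = R (R x * y + x * R y)) :
    NonUnitalSubring A where
  carrier := {x | R x = 0}
  add_mem' {x y} hx hy := by
    simp only [Set.mem_ofPred_eq] at *
    rw [map_add, hx, hy, add_zero]
  zero_mem' := map_zero R
  neg_mem' {x} hx := by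
    simp only [Set.mem_ofPred_eq] at *
    rw [map_neg, hx, neg_zero]
  mul_mem' {x y} hx hy := by
    simp only [Set.mem_ofPred_eq] at *
    simpa [hx, hy] using hR x y

/-- Let `(A,R)` be a commutative Rota–Baxter algebra of weight one
with `R` idempotent, `R̃ := id − R`, `n ≥ 1`, `a ∈ M_n(A)` strictly upper triangular.
If `1 + a = (1 + 𝓡(u))⁻¹·(1 + 𝓡̃(v)) = (1 + 𝓡(u'))⁻¹·(1 + 𝓡̃(v'))` with
`u, v, u', v'` strictly upper triangular, then `𝓡(u) = 𝓡(u')` and `𝓡̃(v) = 𝓡̃(v')`: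
the decomposition is unique. -/
theorem matrix_decomposition_unique {K A : Type*} [Field K] [CharZero K]
    [CommRing A] [Algebra K A] (R : A →ₗ[K] A)
    (hR : ∀ x y : A, R x * R y + R (x * y) = R (R x * y + x * R y))
    (hRidem : ∀ x : A, R (R x) = R x)
    (n : ℕ) (hn : 1 ≤ n)
    (a u v u' v' : Matrix (Fin n) (Fin n) A)
    (ha : ∀ i j : Fin n, j ≤ i → a i j = 0)
    (hu : ∀ i j : Fin n, j ≤ i → u i j = 0)
    (hv : ∀ i j : Fin n, j ≤ i → v i j = 0)
    (hu' : ∀ i j : Fin n, j ≤ i → u' i j = 0)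
    (hv' : ∀ i j : Fin n, j ≤ i → v' i j = 0)
    (h1 : 1 + a = (1 + u.map ⇑R)⁻¹ * (1 + v.map (fun x => x - R x)))
    (h2 : 1 + a = (1 + u'.map ⇑R)⁻¹ * (1 + v'.map (fun x => x - R x))) :
    u.map ⇑R = u'.map ⇑R ∧
      v.map (fun x => x - R x) = v'.map (fun x => x - R x) := by
  have hfix : ∀ w : Matrix (Fin n) (Fin n) A, ∀ i j,
      w.map ⇑R i j ∈ rotaBaxterFixed R.toAddMonoidHom hR := fun w i j => hRidem (w i j)
  have hker : ∀ w : Matrix (Fin n) (Fin n) A, ∀ i j,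
      w.map (fun x => x - R x) i j ∈ rotaBaxterKer R.toAddMonoidHom hR := fun w i j => by
    change R (w i j - R (w i j)) = 0
    rw [map_sub, hRidem, sub_self]
  have hmap : ∀ w : Matrix (Fin n) (Fin n) A, (∀ i j, j ≤ i → w i j = 0) →
      ∀ i j, j ≤ i → w.map ⇑R i j = 0 := fun w hw i j hij => by
    simp [hw i j hij]
  have hmapv : ∀ i j, j ≤ i → v.map (fun x => x - R x) i j = 0 := fun i j hij => by
    simp [hv i j hij]
  have hunit : ∀ w : Matrix (Fin n) (Fin n) A, (∀ i j, j ≤ i → w i j = 0) →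
      IsUnit (1 + w.map ⇑R).det := fun w hw => by
    rw [Matrix.det_one_add_of_strictUpper (hmap w hw)]
    exact isUnit_one
  have hPu := hunit u hu
  have hQ : (1 + u.map ⇑R) * (1 + a) = 1 + v.map (fun x => x - R x) := by
    rw [h1, Matrix.mul_nonsing_inv_cancel_left _ _ hPu]
  have hQ' : (1 + u'.map ⇑R) * (1 + a) = 1 + v'.map (fun x => x - R x) := by
    rw [h2, Matrix.mul_nonsing_inv_cancel_left _ _ (hunit u' hu')]
  obtain ⟨m, hm⟩ : ∃ m, (1 + m) * (1 + u.map ⇑R) = 1 + u'.map ⇑R :=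
    ⟨(1 + u'.map ⇑R) * (1 + u.map ⇑R)⁻¹ - 1, by
      rw [add_sub_cancel, Matrix.nonsing_inv_mul_cancel_right _ _ hPu]⟩
  have hm' : (1 + m) * (1 + v.map (fun x => x - R x)) = 1 + v'.map (fun x => x - R x) := by
    rw [← hQ, ← mul_assoc, hm, hQ']
  have hm0 : m = 0 := by
    ext i j
    have h_fixed : R (m i j) = m i j :=
      Matrix.mem_of_add_mul_strictUpper_eq (rotaBaxterFixed R.toAddMonoidHom hR)
        (d := u'.map ⇑R - u.map ⇑R) (hmap u hu) (hfix u)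
        (fun i j => sub_mem (hfix u' i j) (hfix u i j))
        (by rw [eq_sub_iff_add_eq, ← add_right_inj 1, ← hm]; noncomm_ring) i j
    have h_ker : R (m i j) = 0 :=
      Matrix.mem_of_add_mul_strictUpper_eq (rotaBaxterKer R.toAddMonoidHom hR)
        (d := v'.map (fun x => x - R x) - v.map (fun x => x - R x)) hmapv (hker v)
        (fun i j => sub_mem (hker v' i j) (hker v i j))
        (by rw [eq_sub_iff_add_eq, ← add_right_inj 1, ← hm']; noncomm_ring) i j
    rw [← h_fixed, h_ker, Matrix.zero_apply]
  rw [hm0, add_zero, one_mul] at hm hm'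
  exact ⟨add_left_cancel hm, add_left_cancel hm'⟩
end

section
/- Let (A,R) be a Rota–Baxter algebra of weight one with A commutative, n ≥ 1, and let a ∈ M_n(A) be strictly upper triangular. Let b ∈ M_n(A) be the unique solution of b = 1 − 𝓡(b·a). Since 1 + a is unipotent upper triangular it is invertible; set ǎ := (1 + a)^{-1} − 1. Then b is invertible and b^{-1} is the unique solution of the equation c = 1 − 𝓡(ǎ·c). -/
namespace Matrix

variable {A : Type*} [CommRing A] {n : ℕ}

theorem blockTriangular_one_add_of_strictlyUpper {a : Matrix (Fin n) (Fin n) A}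
    (ha : ∀ i j : Fin n, j ≤ i → a i j = 0) : (1 + a).BlockTriangular id :=
  blockTriangular_one.add fun i j hij => ha i j (le_of_lt hij)

theorem isUnit_one_add_of_strictlyUpper {a : Matrix (Fin n) (Fin n) A}
    (ha : ∀ i j : Fin n, j ≤ i → a i j = 0) : IsUnit (1 + a) := by
  rw [isUnit_iff_isUnit_det,
    det_of_isUpperTriangular (blockTriangular_one_add_of_strictlyUpper ha)]
  simp [ha]

theorem inv_one_add_sub_one_strictlyUpper {a : Matrix (Fin n) (Fin n) A}
    (ha : ∀ i j : Fin n, j ≤ i → a i j = 0) (i j : Fin n) (hij : j ≤ i) :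
    ((1 + a)⁻¹ - 1) i j = 0 := by
  have hunit := isUnit_one_add_of_strictlyUpper ha
  have hinv : ((1 + a)⁻¹).BlockTriangular id := by
    have : Invertible (1 + a) := hunit.invertible
    exact blockTriangular_inv_of_blockTriangular
      (blockTriangular_one_add_of_strictlyUpper ha)
  have hmul : (1 + a) * (1 + a)⁻¹ = 1 :=
    mul_nonsing_inv _ ((isUnit_iff_isUnit_det _).1 hunit)
  have heq : (1 + a)⁻¹ - 1 = -(a * (1 + a)⁻¹) := by
    rw [add_mul, one_mul] at hmul
    rw [sub_eq_iff_eq_add, ← sub_eq_neg_add, eq_sub_iff_add_eq, hmul]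
  rw [heq, neg_apply, mul_apply, neg_eq_zero]
  refine Finset.sum_eq_zero fun l _ => ?_
  rcases le_or_gt l i with h | h
  · rw [ha i l h, zero_mul]
  · rw [hinv (show id j < id l from hij.trans_lt h), mul_zero]

/-- Entrywise application of an additive map after left multiplication by a strictly upper
triangular matrix is nilpotent, so the associated affine equation is solvable. -/
theorem exists_eq_one_sub_map_mul (f : A →+ A) {u : Matrix (Fin n) (Fin n) A}
    (hu : ∀ i j : Fin n, j ≤ i → u i j = 0) :
    ∃ c : Matrix (Fin n) (Fin n) A, c = 1 - (u * c).map f := by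
  let T : AddMonoid.End (Matrix (Fin n) (Fin n) A) :=
    f.mapMatrix.comp (AddMonoidHom.mulLeft u)
  have hT (c : Matrix (Fin n) (Fin n) A) : T c = (u * c).map f := rfl
  have hpow (k : ℕ) (c : Matrix (Fin n) (Fin n) A) (i j : Fin n) (hik : n ≤ i + k) :
      (T ^ k) c i j = 0 := by
    induction k generalizing i with
    | zero => omega
    | succ k ih =>
      rw [pow_succ', AddMonoid.End.coe_mul, Function.comp_apply, hT, map_apply, mul_apply,
        Finset.sum_eq_zero, map_zero]
      intro l _
      rcases le_or_gt l i with h | h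
      · rw [hu i l h, zero_mul]
      · rw [ih l (by have : (i : ℕ) < l := h
                     omega), mul_zero]
  have hnil : IsNilpotent T :=
    ⟨n, by ext c i j; exact hpow n c i j (by omega)⟩
  obtain ⟨v, hv⟩ := hnil.isUnit_one_add
  refine ⟨(↑v⁻¹ : AddMonoid.End (Matrix (Fin n) (Fin n) A)) 1, ?_⟩
  have h := DFunLike.congr_fun v.mul_inv (1 : Matrix (Fin n) (Fin n) A)
  rw [hv, AddMonoid.End.coe_mul, Function.comp_apply] at h
  exact eq_sub_of_add_eq h

theorem rotaBaxter_map {f : A →+ A}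
    (hf : ∀ x y : A, f x * f y + f (x * y) = f (f x * y + x * f y))
    (x y : Matrix (Fin n) (Fin n) A) :
    x.map f * y.map f + (x * y).map f = (x.map f * y + x * y.map f).map f := by
  ext i j
  simp only [add_apply, map_apply, mul_apply, map_sum, ← Finset.sum_add_distrib, hf]

theorem mul_eq_one_of_rotaBaxter {f : A →+ A}
    (hf : ∀ x y : A, f x * f y + f (x * y) = f (f x * y + x * f y))
    {a u b c : Matrix (Fin n) (Fin n) A} (hau : (1 + a) * (1 + u) = 1)
    (hb : b = 1 - (b * a).map f) (hc : c = 1 - (u * c).map f) : b * c = 1 := by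
  have hX : (b * a).map f = 1 - b := by rw [eq_sub_iff_add_eq', ← eq_sub_iff_add_eq]; exact hb
  have hY : (u * c).map f = 1 - c := by rw [eq_sub_iff_add_eq', ← eq_sub_iff_add_eq]; exact hc
  have hzero : a + u + a * u = 0 := by
    have : (1 + a) * (1 + u) = 1 + (a + u + a * u) := by noncomm_ring
    rwa [this, add_eq_left] at hau
  have harg : (1 - b) * (u * c) + b * a * (1 - c) = b * a + u * c + b * a * (u * c) := by
    have : (1 - b) * (u * c) + b * a * (1 - c)
        = b * a + u * c + b * a * (u * c) - b * (a + u + a * u) * c := by noncomm_ring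
    rw [this, hzero, mul_zero, zero_mul, sub_zero]
  have h := rotaBaxter_map hf (b * a) (u * c)
  rw [hX, hY, harg, Matrix.map_add f (map_add f), Matrix.map_add f (map_add f), hX, hY,
    add_left_inj] at h
  have : b * c = (1 - b) * (1 - c) - (1 - b + (1 - c)) + 1 := by noncomm_ring
  rw [this, h, sub_self, zero_add]

end Matrix

/-- Let `(A,R)` be a commutative Rota–Baxter algebra of weight one,
`n ≥ 1`, `a ∈ M_n(A)` strictly upper triangular, and `b` the unique solution of
`b = 1 − 𝓡(b·a)`. With `ǎ := (1 + a)⁻¹ − 1`, the matrix `b` is invertible and `b⁻¹`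
is the unique solution of `c = 1 − 𝓡(ǎ·c)`. -/
theorem matrix_inverse_counterterm {K A : Type*} [Field K] [CharZero K]
    [CommRing A] [Algebra K A] (R : A →ₗ[K] A)
    (hR : ∀ x y : A, R x * R y + R (x * y) = R (R x * y + x * R y))
    (n : ℕ) (hn : 1 ≤ n)
    (a : Matrix (Fin n) (Fin n) A)
    (ha : ∀ i j : Fin n, j ≤ i → a i j = 0)
    (b : Matrix (Fin n) (Fin n) A)
    (hb : b = 1 - (b * a).map ⇑R) :
    IsUnit b ∧
    b⁻¹ = 1 - (((1 + a)⁻¹ - 1) * b⁻¹).map ⇑R ∧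
    (∀ c : Matrix (Fin n) (Fin n) A,
      c = 1 - (((1 + a)⁻¹ - 1) * c).map ⇑R → c = b⁻¹) := by
  have hunit := Matrix.isUnit_one_add_of_strictlyUpper ha
  have hau : (1 + a) * (1 + ((1 + a)⁻¹ - 1)) = 1 := by
    rw [add_sub_cancel]
    exact Matrix.mul_nonsing_inv _ ((Matrix.isUnit_iff_isUnit_det _).1 hunit)
  have key (c : Matrix (Fin n) (Fin n) A)
      (hc : c = 1 - (((1 + a)⁻¹ - 1) * c).map ⇑R) : b * c = 1 :=
    Matrix.mul_eq_one_of_rotaBaxter (f := R.toAddMonoidHom) hR hau hb hc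
  obtain ⟨c, hc⟩ := Matrix.exists_eq_one_sub_map_mul R.toAddMonoidHom
    (Matrix.inv_one_add_sub_one_strictlyUpper ha)
  have hbc : b⁻¹ = c := Matrix.inv_eq_right_inv (key c hc)
  exact ⟨IsUnit.of_mul_eq_one c (key c hc), hbc ▸ hc,
    fun d hd => (Matrix.inv_eq_right_inv (key d hd)).symm⟩
end

section
/- Let (A,R) be a Rota–Baxter algebra of weight one with A commutative, n ≥ 1, and let α ∈ M_n(A) be unipotent upper triangular. Then the unique solution β ∈ M_n(A) of the equation β = 1 − 𝓡((α − 1)·β) is given entrywise by: β_{ij} = 0 for i > j, β_{ii} = 1, and for i < j, β_{ij} = −R(α_{ij}) − Σ_{k=2}^{j−i} Σ_{i < l₁ < l₂ < ⋯ < l_{k−1} < j} (−1)^{k+1} R(α_{i l₁} R(α_{l₁ l₂} R(α_{l₂ l₃} ⋯ R(α_{l_{k−1} j}) ⋯ ))), where the inner sum runs over all strictly increasing chains i < l₁ < ⋯ < l_{k−1} < j of indices. -/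
/-- The right-nested Rota–Baxter word associated to a chain `i, l₁, …, l_{k−1}, j`:
`nestedR R α i [l₁, …, l_{k−1}] j = R(α_{i l₁} R(α_{l₁ l₂} ⋯ R(α_{l_{k−1} j}) ⋯ ))`,
with `nestedR R α i [] j = R(α_{ij})`. -/
def nestedR {n : ℕ} {A : Type*} [CommRing A] (R : A → A)
    (α : Matrix (Fin n) (Fin n) A) : Fin n → List (Fin n) → Fin n → A
  | i, [], j => R (α i j)
  | i, l :: ls, j => R (α i l * nestedR R α l ls j)

/-- A sum over the subsets of an open interval splits off the empty set and sorts the remaining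
subsets by their least element. -/
theorem sum_powerset_Ioo {ι M : Type*} [LinearOrder ι] [LocallyFiniteOrder ι] [AddCommMonoid M]
    (f : Finset ι → M) (i j : ι) :
    ∑ S ∈ (Finset.Ioo i j).powerset, f S =
      f ∅ + ∑ k ∈ Finset.Ioo i j, ∑ S ∈ (Finset.Ioo k j).powerset, f (insert k S) := by
  rw [← Finset.add_sum_erase _ _ (Finset.empty_mem_powerset _), Finset.sum_sigma']
  congr 1
  symm
  refine Finset.sum_bij (fun p _ => insert p.1 p.2) ?_ ?_ ?_ (fun _ _ => rfl)
  · rintro ⟨k, S⟩ h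
    simp only [Finset.mem_sigma, Finset.mem_powerset, Finset.mem_Ioo] at h
    simp only [Finset.mem_erase, Finset.mem_powerset, Finset.insert_subset_iff, Finset.mem_Ioo]
    exact ⟨Finset.insert_ne_empty _ _, h.1, h.2.trans (Finset.Ioo_subset_Ioo_left h.1.1.le)⟩
  · rintro ⟨k, S⟩ h ⟨l, T⟩ h' heq
    simp only [Finset.mem_sigma, Finset.mem_powerset] at h h' heq
    have hS : ∀ x ∈ S, k < x := fun x hx => (Finset.mem_Ioo.1 (h.2 hx)).1
    have hT : ∀ x ∈ T, l < x := fun x hx => (Finset.mem_Ioo.1 (h'.2 hx)).1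
    have hkl : k = l := by
      have hk : k ∈ insert l T := heq ▸ Finset.mem_insert_self k S
      have hl : l ∈ insert k S := heq ▸ Finset.mem_insert_self l T
      rcases Finset.mem_insert.1 hk with e | hk
      · exact e
      rcases Finset.mem_insert.1 hl with e | hl
      · exact e.symm
      exact absurd (hT _ hk) (hS _ hl).asymm
    subst hkl
    have hST : S = T := by
      rw [← Finset.erase_insert fun hx => lt_irrefl _ (hS k hx), heq,
        Finset.erase_insert fun hx => lt_irrefl _ (hT k hx)]
    rw [hST]
  · intro S hS
    rw [Finset.mem_erase, Finset.mem_powerset] at hS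
    have hne := Finset.nonempty_iff_ne_empty.2 hS.1
    have hmem := S.min'_mem hne
    refine ⟨⟨S.min' hne, S.erase (S.min' hne)⟩, ?_, Finset.insert_erase hmem⟩
    simp only [Finset.mem_sigma, Finset.mem_powerset]
    refine ⟨hS.2 hmem, fun x hx => Finset.mem_Ioo.2 ⟨S.min'_lt_of_mem_erase_min' hne hx, ?_⟩⟩
    exact (Finset.mem_Ioo.1 (hS.2 (Finset.mem_of_mem_erase hx))).2

section Counterterm

variable {n : ℕ} {A : Type*} [CommRing A]

/-- The signed sum of the nested words over all strictly increasing chains from `i` to `j`. -/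
def chainSum (R : A → A) (α : Matrix (Fin n) (Fin n) A) (i j : Fin n) : A :=
  ∑ S ∈ (Finset.Ioo i j).powerset,
    (-1 : A) ^ (S.card + 1) * nestedR R α i (S.sort (· ≤ ·)) j

/-- The unipotent upper triangular matrix with the chain sums above the diagonal. -/
def chainMatrix (R : A → A) (α : Matrix (Fin n) (Fin n) A) : Matrix (Fin n) (Fin n) A :=
  fun i j => if i < j then chainSum R α i j else (1 : Matrix (Fin n) (Fin n) A) i j

theorem map_neg_one_pow_mul (R : A →+ A) (m : ℕ) (x : A) :
    R ((-1) ^ m * x) = (-1) ^ m * R x := by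
  rcases neg_one_pow_eq_or A m with h | h <;> simp [h]

theorem chainSum_eq (R : A →+ A) (α : Matrix (Fin n) (Fin n) A) (i j : Fin n) :
    chainSum R α i j =
      -R (α i j) - ∑ k ∈ Finset.Ioo i j, R (α i k * chainSum R α k j) := by
  rw [chainSum, sum_powerset_Ioo, sub_eq_add_neg, ← Finset.sum_neg_distrib]
  congr 1
  · simp [nestedR]
  refine Finset.sum_congr rfl fun k _ => ?_
  rw [chainSum, Finset.mul_sum, map_sum, ← Finset.sum_neg_distrib]
  refine Finset.sum_congr rfl fun S hS => ?_
  have hlt : ∀ x ∈ S, k < x := fun x hx =>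
    (Finset.mem_Ioo.1 (Finset.mem_powerset.1 hS hx)).1
  have hk : k ∉ S := fun hx => lt_irrefl _ (hlt k hx)
  rw [Finset.sort_insert (· ≤ ·) (fun _ hx => (hlt _ hx).le) hk, Finset.card_insert_of_notMem hk,
    nestedR, mul_left_comm, map_neg_one_pow_mul]
  ring

variable {α : Matrix (Fin n) (Fin n) A}

theorem sub_one_mul_apply (hα : ∀ i j : Fin n, j < i → α i j = 0) (hαdiag : ∀ i, α i i = 1)
    (β : Matrix (Fin n) (Fin n) A) (i j : Fin n) :
    ((α - 1) * β) i j = ∑ k ∈ Finset.Ioi i, α i k * β k j := by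
  rw [Matrix.mul_apply, ← Finset.sum_subset (Finset.subset_univ (Finset.Ioi i))]
  · refine Finset.sum_congr rfl fun k hk => ?_
    simp [Matrix.one_apply_ne (Finset.mem_Ioi.1 hk).ne]
  · intro k _ hk
    rw [Finset.mem_Ioi, not_lt] at hk
    rcases hk.eq_or_lt with rfl | hk
    · simp [hαdiag]
    · simp [hα i k hk, Matrix.one_apply_ne hk.ne']

theorem chainMatrix_eq (R : A →+ A) (hα : ∀ i j : Fin n, j < i → α i j = 0)
    (hαdiag : ∀ i, α i i = 1) :
    chainMatrix R α = 1 - ((α - 1) * chainMatrix R α).map R := by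
  ext i j
  rw [Matrix.sub_apply, Matrix.map_apply, sub_one_mul_apply hα hαdiag]
  by_cases hij : i < j
  · have hzero : ∀ k ∈ Finset.Ioi i, k ∉ Finset.Ioc i j → α i k * chainMatrix R α k j = 0 := by
      intro k hk hk'
      have hjk : j < k := by simpa [Finset.mem_Ioi.1 hk] using hk'
      simp [chainMatrix, hjk.asymm, Matrix.one_apply_ne hjk.ne']
    rw [← Finset.sum_subset (fun k hk => Finset.mem_Ioi.2 (Finset.mem_Ioc.1 hk).1) hzero,
      ← Finset.Ioo_insert_right hij, Finset.sum_insert (by simp), map_add, map_sum,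
      Finset.sum_congr rfl fun k hk => by
        rw [chainMatrix, if_pos (Finset.mem_Ioo.1 hk).2]]
    simp only [chainMatrix, hij, if_true, lt_irrefl, if_false, Matrix.one_apply_eq, mul_one,
      Matrix.one_apply_ne hij.ne]
    rw [chainSum_eq]
    ring
  · rw [Finset.sum_eq_zero, map_zero, sub_zero, chainMatrix, if_neg hij]
    intro k hk
    have hjk : j < k := (not_lt.1 hij).trans_lt (Finset.mem_Ioi.1 hk)
    simp [chainMatrix, hjk.asymm, Matrix.one_apply_ne hjk.ne']

theorem counterterm_unique (R : A → A) (hα : ∀ i j : Fin n, j < i → α i j = 0)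
    (hαdiag : ∀ i, α i i = 1) {β γ : Matrix (Fin n) (Fin n) A}
    (hβ : β = 1 - ((α - 1) * β).map R) (hγ : γ = 1 - ((α - 1) * γ).map R) : β = γ := by
  ext i j
  induction i using WellFoundedGT.induction with
  | ind i ih =>
    rw [hβ, hγ, Matrix.sub_apply, Matrix.sub_apply, Matrix.map_apply, Matrix.map_apply,
      sub_one_mul_apply hα hαdiag, sub_one_mul_apply hα hαdiag,
      Finset.sum_congr rfl fun k hk => by rw [ih k (Finset.mem_Ioi.1 hk)]]

end Counterterm


/-- Let `(A,R)` be a commutative Rota–Baxter algebra of weight one,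
`n ≥ 1`, and `α ∈ M_n(A)` unipotent upper triangular. The equation
`β = 1 − 𝓡((α − 1)·β)` has a unique solution, whose entries are `0` below the diagonal,
`1` on the diagonal, and for `i < j` are given by the sum over all strictly increasing
chains `i < l₁ < ⋯ < l_{k−1} < j` (equivalently, subsets `S ⊆ (i,j)`, with the chain
read off as `S` sorted increasingly) of
`(−1)^{k} R(α_{i l₁} R(α_{l₁ l₂} ⋯ R(α_{l_{k−1} j}) ⋯ ))`, i.e.
`β_{ij} = −R(α_{ij}) − Σ_{k=2}^{j−i} Σ_{i<l₁<⋯<l_{k−1}<j} (−1)^{k+1} R(α_{i l₁} R(⋯))`. -/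
theorem matrix_counterterm_formula {K A : Type*} [Field K] [CharZero K]
    [CommRing A] [Algebra K A] (R : A →ₗ[K] A)
    (hR : ∀ x y : A, R x * R y + R (x * y) = R (R x * y + x * R y))
    (n : ℕ) (hn : 1 ≤ n)
    (α : Matrix (Fin n) (Fin n) A)
    (hα : ∀ i j : Fin n, j < i → α i j = 0)
    (hαdiag : ∀ i : Fin n, α i i = 1) :
    (∃! β : Matrix (Fin n) (Fin n) A, β = 1 - ((α - 1) * β).map ⇑R) ∧
    (∀ β : Matrix (Fin n) (Fin n) A, β = 1 - ((α - 1) * β).map ⇑R →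
      (∀ i j : Fin n, j < i → β i j = 0) ∧
      (∀ i : Fin n, β i i = 1) ∧
      (∀ i j : Fin n, i < j →
        β i j = ∑ S ∈ (Finset.Ioo i j).powerset,
          (-1 : A) ^ (S.card + 1) * nestedR ⇑R α i (S.sort (· ≤ ·)) j)) := by
  have hsol := chainMatrix_eq R.toAddMonoidHom hα hαdiag
  refine ⟨⟨_, hsol, fun γ hγ => counterterm_unique R hα hαdiag hγ hsol⟩, fun β hβ => ?_⟩
  obtain rfl := counterterm_unique R hα hαdiag hβ hsol
  refine ⟨fun i j hij => ?_, fun i => ?_, fun i j hij => ?_⟩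
  · rw [chainMatrix, if_neg hij.asymm, Matrix.one_apply_ne hij.ne']
  · rw [chainMatrix, if_neg (lt_irrefl i), Matrix.one_apply_eq]
  · rw [chainMatrix, if_pos hij]
    rfl
end

section
/- Let A be a commutative unital algebra over a field of characteristic zero and let R : A → A be a linear map satisfying the weight-zero Rota–Baxter relation R(x)R(y) = R(R(x)y + xR(y)) for all x, y ∈ A. Define (Ra)^[n] recursively by (Ra)^[0] = 1 and (Ra)^[n+1] = R((Ra)^[n]·a). Then for every a ∈ A and every n ≥ 0, R(a)^n = n!·(Ra)^[n]. -/
/-- The iterated Rota–Baxter words `(Ra)^[n]`, defined by `(Ra)^[0] = 1` and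
`(Ra)^[n+1] = R((Ra)^[n]·a)`. -/
def RaPow {A : Type*} [CommRing A] (R : A → A) (a : A) : ℕ → A
  | 0 => 1
  | k + 1 => R (RaPow R a k * a)

/-- Multiplying an iterated Rota–Baxter word by `R a` raises its index, up to a factor. -/
theorem RaPow_mul_self {K A : Type*} [Field K] [CommRing A] [Algebra K A] (R : A →ₗ[K] A)
    (hR : ∀ x y : A, R x * R y = R (R x * y + x * R y)) (a : A) (n : ℕ) :
    RaPow R a n * R a = (n + 1) • RaPow R a (n + 1) := by
  induction n with
  | zero => simp [RaPow]
  | succ n ih =>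
    calc RaPow R a (n + 1) * R a
        = R (RaPow R a (n + 1) * a + RaPow R a n * R a * a) := by
          rw [mul_right_comm (RaPow R a n)]
          exact hR _ _
      _ = R ((n + 1 + 1) • (RaPow R a (n + 1) * a)) := by
          rw [ih, smul_mul_assoc, succ_nsmul' _ (n + 1)]
      _ = (n + 1 + 1) • RaPow R a (n + 1 + 1) := map_nsmul R _ _

/-- Let `A` be a commutative unital algebra over a field of
characteristic zero and `R` a linear map satisfying the weight-zero Rota–Baxter
relation `R(x)R(y) = R(R(x)y + xR(y))`. Then `R(a)^n = n!·(Ra)^[n]` for all `a ∈ A`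
and `n ≥ 0`. -/
theorem weight_zero_spitzer {K A : Type*} [Field K] [CharZero K]
    [CommRing A] [Algebra K A] (R : A →ₗ[K] A)
    (hR : ∀ x y : A, R x * R y = R (R x * y + x * R y))
    (a : A) (n : ℕ) :
    (R a) ^ n = n.factorial • RaPow ⇑R a n := by
  induction n with
  | zero => simp [RaPow]
  | succ n ih =>
    rw [pow_succ, ih, smul_mul_assoc, RaPow_mul_self R hR, ← mul_smul, Nat.factorial_succ,
      mul_comm]
end
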